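/- Let (E, L, τ) be an isodual Euclidean lattice whose associated bilinear form b_τ is symmetric or alternating. If (E, L) is unstable, then its destabilizing subspace E₁ is totally isotropic with respect to b_τ (i.e. b_τ(x, y) = 0 for all x, y ∈ E₁); in particular dim E₁ ≤ (dim E)/2. -/

import Mathlib

open Module

noncomputable section

namespace EucLat

variable {E : Type*} [NormedAddCommGroup E] [InnerProductSpace ℝ E]

/-- The covolume of a `ℤ`-submodule of a real inner product space: the square root of the
Gram determinant of a `ℤ`-basis (junk value `0` if no finite basis exists). -/
def covol (L : Submodule ℤ E) : ℝ :=
  @dite _ (∃ n : ℕ, Nonempty (Basis (Fin n) ℤ L)) (Classical.propDecidable _)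
    (fun h => Real.sqrt (Matrix.det (Matrix.of fun i j =>
      (inner ℝ ((h.choose_spec.some i : L) : E) ((h.choose_spec.some j : L) : E) : ℝ))))
    (fun _ => 0)

/-- The reduced height `covol(L)^(1/dim E)` of a full lattice. -/
def redH (L : Submodule ℤ E) : ℝ := covol L ^ ((finrank ℝ E : ℝ)⁻¹)

/-- The lattice `L ∩ F` induced on a subspace `F`. -/
def latIn (L : Submodule ℤ E) (F : Submodule ℝ E) : Submodule ℤ F :=
  L.comap (F.subtype.restrictScalars ℤ)

/-- The reduced height of a subspace: `covol(F ∩ L)^(1/dim F)`. -/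
def Hr (L : Submodule ℤ E) (F : Submodule ℝ E) : ℝ := redH (latIn L F)

/-- A subspace is rational if it is spanned by its intersection with the lattice. -/
def IsRational (L : Submodule ℤ E) (F : Submodule ℝ E) : Prop :=
  Submodule.span ℝ ((L : Set E) ∩ (F : Set E)) = F

/-- `(E, L)` is a Euclidean lattice: `L` is discrete and spans `E` over `ℝ`. -/
def IsLat (L : Submodule ℤ E) : Prop :=
  DiscreteTopology L ∧ Submodule.span ℝ (L : Set E) = ⊤

/-- Minimal reduced height: infimum of reduced heights of nonzero rational subspaces. -/
def Hmin (L : Submodule ℤ E) : ℝ :=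
  sInf {h : ℝ | ∃ F : Submodule ℝ E, F ≠ ⊥ ∧ IsRational L F ∧ h = Hr L F}

/-- Semistability of a Euclidean lattice. -/
def Semistable (L : Submodule ℤ E) : Prop :=
  ∀ F : Submodule ℝ E, F ≠ ⊥ → IsRational L F → redH L ≤ Hr L F

/-- Stability of a Euclidean lattice. -/
def Stable (L : Submodule ℤ E) : Prop :=
  Semistable L ∧ ∀ F : Submodule ℝ E, F ≠ ⊥ → F ≠ ⊤ → IsRational L F → redH L < Hr L F

/-- The quotient lattice of `(E, L)` by a subspace `F`: the image of `L` under the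
orthogonal projection of `E` onto `Fᗮ`. -/
def quotLat [FiniteDimensional ℝ E] (L : Submodule ℤ E) (F : Submodule ℝ E) :
    Submodule ℤ Fᗮ :=
  L.map ((Submodule.orthogonalProjection Fᗮ : E →ₗ[ℝ] Fᗮ).restrictScalars ℤ)

/-- For subspaces `F ≤ F'`, the successive quotient lattice: the image of `F' ∩ L` under the
orthogonal projection of `F'` onto the orthogonal complement of `F` inside `F'`. -/
def succQuot [FiniteDimensional ℝ E] (L : Submodule ℤ E) (F F' : Submodule ℝ E) :
    Submodule ℤ ((F.comap F'.subtype)ᗮ) :=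
  quotLat (latIn L F') (F.comap F'.subtype)

/-- A GS-flag of `(E, L)`. -/
def IsGSFlag [FiniteDimensional ℝ E] (L : Submodule ℤ E) {ℓ : ℕ}
    (C : Fin (ℓ + 1) → Submodule ℝ E) : Prop :=
  C 0 = ⊥ ∧ C (Fin.last ℓ) = ⊤ ∧
  (∀ i : Fin ℓ, C i.castSucc < C i.succ) ∧
  (∀ i, IsRational L (C i)) ∧
  (∀ i : Fin ℓ, Semistable (succQuot L (C i.castSucc) (C i.succ))) ∧
  (∀ i j : Fin ℓ, i < j →
    redH (succQuot L (C i.castSucc) (C i.succ)) < redH (succQuot L (C j.castSucc) (C j.succ)))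

/-- The dual lattice `L* = {y : ⟪x, y⟫ ∈ ℤ for all x ∈ L}`. -/
def dualLat (L : Submodule ℤ E) : Submodule ℤ E where
  carrier := {y | ∀ x ∈ L, ∃ n : ℤ, (inner ℝ x y : ℝ) = n}
  zero_mem' := fun x _ => ⟨0, by simp⟩
  add_mem' := by
    intro a b ha hb x hx
    obtain ⟨m, hm⟩ := ha x hx
    obtain ⟨n, hn⟩ := hb x hx
    exact ⟨m + n, by rw [inner_add_right, hm, hn]; push_cast; ring⟩
  smul_mem' := by
    intro z y hy x hx
    obtain ⟨n, hn⟩ := hy x hx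
    refine ⟨z * n, ?_⟩
    rw [← Int.cast_smul_eq_zsmul ℝ, real_inner_smul_right, hn]
    push_cast; ring

/-- `(E, L)` is isodual via the similarity `τ`. -/
def IsIsodual (L : Submodule ℤ E) (τ : E →ₗ[ℝ] E) : Prop :=
  (∃ α : ℝ, 0 < α ∧ ∀ x y : E, (inner ℝ (τ x) (τ y) : ℝ) = α * inner ℝ x y) ∧
  L.map (τ.restrictScalars ℤ) = dualLat L

/-- The bilinear form `b_τ(x, y) = ⟪τ x, y⟫` associated with an isoduality. -/
def bform (τ : E →ₗ[ℝ] E) (x y : E) : ℝ := inner ℝ (τ x) y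

/-- `b` has signature `s`: there is a `b`-orthogonal basis with `p - q = s`. -/
def HasSignature (b : E → E → ℝ) (s : ℤ) : Prop :=
  ∃ (n : ℕ) (v : Basis (Fin n) ℝ E),
    (∀ i j, i ≠ j → b (v i) (v j) = 0) ∧
    s = ((Finset.univ.filter fun i => 0 < b (v i) (v i)).card : ℤ) -
        ((Finset.univ.filter fun i => b (v i) (v i) < 0).card : ℤ)

/-- The destabilizing subspace of `(E, L)`. -/
def IsDestabilizing (L : Submodule ℤ E) (F : Submodule ℝ E) : Prop :=
  F ≠ ⊥ ∧ IsRational L F ∧ Hr L F = Hmin L ∧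
  ∀ F' : Submodule ℝ E, F' ≠ ⊥ → IsRational L F' → Hr L F' = Hmin L → F' ≤ F

/-- `(G, t)` is a realization of the tensor product of the inner product spaces `E` and `F`:
`t` induces a linear isomorphism `E ⊗ F ≃ G` and
`⟪t x y, t x' y'⟫ = ⟪x, x'⟫ * ⟪y, y'⟫` on pure tensors. -/
def IsTensor {F G : Type*} [NormedAddCommGroup F] [InnerProductSpace ℝ F]
    [NormedAddCommGroup G] [InnerProductSpace ℝ G] (t : E →ₗ[ℝ] F →ₗ[ℝ] G) : Prop :=
  Function.Bijective (TensorProduct.lift t) ∧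
  ∀ (x x' : E) (y y' : F),
    (inner ℝ (t x y) (t x' y') : ℝ) = (inner ℝ x x' : ℝ) * (inner ℝ y y' : ℝ)

/-- The tensor product lattice `L·M`: the additive subgroup generated by pure tensors. -/
def tensorLat {F G : Type*} [NormedAddCommGroup F] [InnerProductSpace ℝ F]
    [NormedAddCommGroup G] [InnerProductSpace ℝ G] (t : E →ₗ[ℝ] F →ₗ[ℝ] G)
    (L : Submodule ℤ E) (M : Submodule ℤ F) : Submodule ℤ G :=
  Submodule.span ℤ (Set.image2 (fun x y => t x y) (L : Set E) (M : Set F))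

/-- `g` is an automorphism of the Euclidean lattice `(E, L)`. -/
def IsAut (L : Submodule ℤ E) (g : E ≃ₗ[ℝ] E) : Prop :=
  (∀ x, x ∈ L ↔ g x ∈ L) ∧ ∀ x y : E, (inner ℝ (g x) (g y) : ℝ) = inner ℝ x y

/-- The direct product lattice `L × L'` inside `WithLp 2 (E × E')`. -/
def prodLat {E' : Type*} [NormedAddCommGroup E'] [InnerProductSpace ℝ E']
    (L : Submodule ℤ E) (L' : Submodule ℤ E') : Submodule ℤ (WithLp 2 (E × E')) :=
  (L.prod L').comap (((WithLp.linearEquiv 2 ℝ (E × E')).restrictScalars ℤ) : WithLp 2 (E × E') →ₗ[ℤ] E × E')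



open Matrix in
theorem det_inner_change {V ι : Type*} [NormedAddCommGroup V] [InnerProductSpace ℝ V]
    [Fintype ι] [DecidableEq ι] (P : Matrix ι ι ℝ) (u v x : ι → V)
    (h : ∀ i, u i = ∑ k, P i k • v k) :
    det (Matrix.of fun i j => (inner ℝ (u i) (x j) : ℝ)) =
      det P * det (Matrix.of fun i j => (inner ℝ (v i) (x j) : ℝ)) := by
  rw [← Matrix.det_mul]
  congr 1
  ext i j
  simp [Matrix.mul_apply, h, sum_inner, real_inner_smul_left]

open Matrix in
theorem det_inner_symm {V ι : Type*} [NormedAddCommGroup V] [InnerProductSpace ℝ V]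
    [Fintype ι] [DecidableEq ι] (u x : ι → V) :
    det (Matrix.of fun i j => (inner ℝ (u i) (x j) : ℝ)) =
      det (Matrix.of fun i j => (inner ℝ (x i) (u j) : ℝ)) := by
  rw [← Matrix.det_transpose]
  congr 1
  ext i j
  simp [real_inner_comm]

open Matrix in
theorem gram_change {V ι : Type*} [NormedAddCommGroup V] [InnerProductSpace ℝ V]
    [Fintype ι] [DecidableEq ι] (P : Matrix ι ι ℝ) (u v : ι → V)
    (h : ∀ i, u i = ∑ k, P i k • v k) :
    det (gram ℝ u) = det P ^ 2 * det (gram ℝ v) := by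
  have h1 := det_inner_change P u v u h
  have h2 := det_inner_change P u v v h
  rw [det_inner_symm v u, h2] at h1
  change det (gram ℝ u) = _ * (_ * det (gram ℝ v)) at h1
  rw [h1]; ring

open Matrix in
theorem covol_eq (L : Submodule ℤ E) {ι : Type*} [Fintype ι] [DecidableEq ι]
    (b : Basis ι ℤ L) : covol L = Real.sqrt (det (gram ℝ (fun i => (b i : E)))) := by
  have h : ∃ n : ℕ, Nonempty (Basis (Fin n) ℤ L) :=
    ⟨Fintype.card ι, ⟨b.reindex (Fintype.equivFin ι)⟩⟩
  unfold covol
  rw [dif_pos h]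
  generalize h.choose_spec.some = e
  congr 1
  let σ := e.indexEquiv b
  have h1 : det (gram ℝ (fun i => (e i : E))) = det (gram ℝ (fun i => (e (σ.symm i) : E))) := by
    have : gram ℝ (fun i => (e (σ.symm i) : E)) =
      (gram ℝ (fun i => (e i : E))).submatrix σ.symm σ.symm := rfl
    rw [this, Matrix.det_submatrix_equiv_self]
  change det (gram ℝ (fun i => (e i : E))) = _
  rw [h1]
  let e' := e.reindex σ
  have h2 : ∀ i, e (σ.symm i) = e' i := fun i => by simp [e']
  simp only [h2]
  have key : ∀ i, ((e' i : L) : E) = ∑ k, ((b.toMatrix e')ᵀ.map (Int.cast : ℤ → ℝ)) i k • (b k : E) := by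
    intro i
    have h4 := congrArg (Subtype.val : L → E) (b.sum_repr (e' i))
    rw [← h4]
    simp [-Module.Basis.sum_repr, Module.Basis.toMatrix_apply, Int.cast_smul_eq_zsmul]
  rw [gram_change _ _ _ key]
  have hu : IsUnit (det (b.toMatrix e')) := by
    have := b.isUnit_det e'
    rwa [Module.Basis.det_apply] at this
  have h3 : det ((b.toMatrix e')ᵀ.map (Int.cast : ℤ → ℝ)) = ((det (b.toMatrix e') : ℤ) : ℝ) := by
    rw [← Matrix.det_transpose (b.toMatrix e')]
    exact ((Int.castRingHom ℝ).map_det _).symm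
  rw [h3]
  rcases Int.isUnit_iff.1 hu with h | h <;> rw [h] <;> simp

theorem latIn_discrete (L : Submodule ℤ E) (hL : DiscreteTopology L) (F : Submodule ℝ E) :
    DiscreteTopology (latIn L F) :=
  ZLattice.comap_discreteTopology ℝ L (e := F.subtype) F.subtypeL.continuous F.injective_subtype

theorem latIn_zlattice (L : Submodule ℤ E) (F : Submodule ℝ E)
    (hF : IsRational L F) : Submodule.span ℝ (latIn L F : Set F) = ⊤ := by
  apply Submodule.map_injective_of_injective F.injective_subtype
  rw [Submodule.map_span, Submodule.map_top, Submodule.range_subtype]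
  conv_rhs => rw [← hF]
  congr 1
  ext x
  simp [latIn, and_comm]

open Matrix in
theorem det_le_pow {V : Type*} [NormedAddCommGroup V] [InnerProductSpace ℝ V]
    [FiniteDimensional ℝ V] (T : V →ₗ[ℝ] V) (a : ℝ) (h : ∀ x, ‖T x‖ ≤ a * ‖x‖) :
    |LinearMap.det T| ≤ a ^ finrank ℝ V := by
  have : Fact (finrank ℝ V = finrank ℝ V) := ⟨rfl⟩
  let o := stdOrthonormalBasis ℝ V
  have h1 := o.toBasis.orientation.abs_volumeForm_apply_le (fun i => T (o i))
  rw [Orientation.volumeForm_robust' _ o] at h1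
  have h2 : o.toBasis.det (fun i => T (o i)) = LinearMap.det T := by
    have := Module.Basis.det_comp o.toBasis T o
    rw [← OrthonormalBasis.coe_toBasis] at this ⊢
    rw [Module.Basis.det_self, mul_one] at this
    exact this
  rw [h2] at h1
  refine h1.trans ?_
  calc _ ≤ ∏ i : Fin (finrank ℝ V), a := by
        apply Finset.prod_le_prod
        · intros; positivity
        · intro i _
          simpa using h (o i)
    _ = _ := by simp

open Matrix in
theorem det_inner_endo {V ι : Type*} [NormedAddCommGroup V] [InnerProductSpace ℝ V]
    [Fintype ι] [DecidableEq ι] (v : Basis ι ℝ V) (T : V →ₗ[ℝ] V) :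
    det (Matrix.of fun i j => (inner ℝ (T (v i)) (v j) : ℝ)) =
      LinearMap.det T * det (gram ℝ v) := by
  rw [det_inner_change (LinearMap.toMatrix v v T)ᵀ (fun i => T (v i)) v v, Matrix.det_transpose,
    LinearMap.det_toMatrix]
  · rfl
  · intro i
    conv_lhs => rw [← v.sum_repr (T (v i))]
    simp [LinearMap.toMatrix_apply]

open Matrix in
theorem det_bform_le {ι : Type*} [Fintype ι] [DecidableEq ι] [FiniteDimensional ℝ E]
    (τ : E →ₗ[ℝ] E) (α : ℝ) (hα : 0 < α)
    (hτ : ∀ x y : E, (inner ℝ (τ x) (τ y) : ℝ) = α * inner ℝ x y)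
    (v : ι → E) (hv : LinearIndependent ℝ v) :
    (det (Matrix.of fun i j => (inner ℝ (τ (v i)) (v j) : ℝ))) ^ 2 ≤
      α ^ Fintype.card ι * det (gram ℝ v) ^ 2 := by
  let S := Submodule.span ℝ (Set.range v)
  let B : Basis ι ℝ S := Basis.span hv
  have hB : ∀ i, ((B i : S) : E) = v i := fun i => congrArg Subtype.val (Basis.span_apply hv i)
  let T : S →ₗ[ℝ] S := (S.orthogonalProjectionOnto : E →ₗ[ℝ] S) ∘ₗ τ ∘ₗ S.subtype
  have hT : ∀ x, ‖T x‖ ≤ Real.sqrt α * ‖x‖ := by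
    intro x
    have h1 : ‖T x‖ ≤ ‖τ x‖ := S.norm_orthogonalProjectionOnto_apply_le (τ x)
    refine h1.trans ?_
    have h2 : ‖τ x‖ ^ 2 = α * ‖(x : E)‖ ^ 2 := by
      rw [← real_inner_self_eq_norm_sq, ← real_inner_self_eq_norm_sq, hτ]
    apply le_of_sq_le_sq _ (by positivity)
    rw [h2, mul_pow, Real.sq_sqrt hα.le]; rfl
  have h3 := det_le_pow T _ hT
  have h4 := det_inner_endo B T
  have h5 : (Matrix.of fun i j => (inner ℝ (T (B i)) (B j) : ℝ)) =
      (Matrix.of fun i j => (inner ℝ (τ (v i)) (v j) : ℝ)) := by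
    ext i j
    have := S.inner_orthogonalProjectionOnto_eq_of_mem_right (B j) (τ (v i))
    simp [T, hB]
  have h6 : gram ℝ B = gram ℝ v := by
    ext i j
    simp [gram_apply, hB]
  rw [h5, h6] at h4
  rw [h4, mul_pow]
  have h7 : finrank ℝ S = Fintype.card ι := Module.finrank_eq_card_basis B
  rw [h7] at h3
  have h8 : LinearMap.det T ^ 2 ≤ α ^ Fintype.card ι := by
    rw [← sq_abs]
    calc _ ≤ (Real.sqrt α ^ Fintype.card ι) ^ 2 := by gcongr
      _ = _ := by rw [← pow_mul, mul_comm, pow_mul, Real.sq_sqrt hα.le]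
  gcongr

open Matrix in
theorem unimod [FiniteDimensional ℝ E] (L : Submodule ℤ E) [DiscreteTopology L] [IsZLattice ℝ L]
    (τ : E →ₗ[ℝ] E) (α : ℝ)
    (hτ : ∀ x y : E, (inner ℝ (τ x) (τ y) : ℝ) = α * inner ℝ x y)
    (hdual : L.map (τ.restrictScalars ℤ) = dualLat L)
    {ι : Type*} [Fintype ι] [DecidableEq ι] (b : Basis ι ℤ L) :
    α ^ Fintype.card ι * det (gram ℝ (fun i => (b i : E))) ^ 2 = 1 := by
  let B : Basis ι ℝ E := b.ofZLatticeBasis ℝ L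
  have hB : ∀ i, B i = (b i : E) := fun i => b.ofZLatticeBasis_apply ℝ L i
  have hgB : gram ℝ (fun i => (b i : E)) = gram ℝ B := by ext i j; simp [gram_apply, hB]
  rw [hgB]
  have hpos : 0 < det (gram ℝ B) := (posDef_gram_of_linearIndependent B.linearIndependent).det_pos
  -- dual vectors
  have hd : ∀ j, ∃ l : L, ∀ i, (inner ℝ (τ (l : E)) (b i : E) : ℝ) = if j = i then 1 else 0 := by
    intro j
    let y : E := (InnerProductSpace.toDual ℝ E).symm (LinearMap.toContinuousLinearMap (B.coord j))
    have hy : ∀ x, (inner ℝ y x : ℝ) = B.repr x j := by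
      intro x
      simp [y, InnerProductSpace.toDual_symm_apply]
    have hmem : y ∈ dualLat L := by
      intro x hx
      refine ⟨b.repr ⟨x, hx⟩ j, ?_⟩
      rw [real_inner_comm, hy]
      exact b.ofZLatticeBasis_repr_apply ℝ L ⟨x, hx⟩ j
    rw [← hdual] at hmem
    obtain ⟨l, hl, hly⟩ := hmem
    refine ⟨⟨l, hl⟩, fun i => ?_⟩
    have : τ l = y := hly
    simp only [this]
    rw [hy, ← hB, B.repr_self, Finsupp.single_apply]
    simp [eq_comm]
  choose l hl using hd
  have hM : ∀ i j, ∃ m : ℤ, (inner ℝ (τ (b i : E)) (b j : E) : ℝ) = m := by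
    intro i j
    have : τ (b i : E) ∈ dualLat L := by
      rw [← hdual]; exact ⟨_, (b i).2, rfl⟩
    obtain ⟨m, hm⟩ := this _ (b j).2
    exact ⟨m, by rw [real_inner_comm, hm]⟩
  choose M hM using hM
  let N : Matrix ι ι ℤ := Matrix.of fun j k => b.repr (l j) k
  have hlE : ∀ j, ((l j : L) : E) = ∑ k, (N j k : ℝ) • (b k : E) := by
    intro j
    have h4 := congrArg (Subtype.val : L → E) (b.sum_repr (l j))
    rw [← h4]
    simp [-Module.Basis.sum_repr, N, Int.cast_smul_eq_zsmul]
  have hNM : N * Matrix.of M = 1 := by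
    ext j i
    have h := hl j i
    rw [hlE] at h
    simp only [map_sum, map_smul, sum_inner, real_inner_smul_left, hM] at h
    rw [Matrix.mul_apply, Matrix.one_apply]
    simp only [Matrix.of_apply]
    exact_mod_cast h
  have hdet : IsUnit (det (Matrix.of M)) := by
    have := congrArg det hNM
    rw [det_mul, det_one] at this
    exact IsUnit.of_mul_eq_one_right _ this
  have hsq : (det (Matrix.of fun i j => (inner ℝ (τ (B i)) (B j) : ℝ))) ^ 2 = 1 := by
    have h3 : det (Matrix.of fun i j => (inner ℝ (τ (B i)) (B j) : ℝ)) =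
        ((det (Matrix.of M) : ℤ) : ℝ) := by
      have h5 := (Int.castRingHom ℝ).map_det (Matrix.of M)
      simp only [eq_intCast] at h5
      rw [h5]
      congr 1
      ext i j
      simp [hB, hM]
    rw [h3]
    rcases Int.isUnit_iff.1 hdet with h | h <;> rw [h] <;> simp
  rw [det_inner_endo B τ, mul_pow] at hsq
  have h6 : det (gram ℝ (fun i => τ (B i))) = LinearMap.det τ ^ 2 * det (gram ℝ B) := by
    rw [gram_change (LinearMap.toMatrix B B τ)ᵀ (fun i => τ (B i)) B, Matrix.det_transpose,
      LinearMap.det_toMatrix]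
    intro i
    conv_lhs => rw [← B.sum_repr (τ (B i))]
    simp [LinearMap.toMatrix_apply]
  have h7 : gram ℝ (fun i => τ (B i)) = α • gram ℝ B := by
    ext i j
    simp [gram_apply, hτ]
  rw [h7, det_smul] at h6
  have h8 := mul_right_cancel₀ hpos.ne' h6
  rw [h8, hsq]

open Matrix in
theorem gram_sum_le [FiniteDimensional ℝ E] {ι κ : Type*} [Fintype ι] [DecidableEq ι]
    [Fintype κ] [DecidableEq κ]
    (τ : E →ₗ[ℝ] E) (α : ℝ) (hα : 0 < α)
    (hτ : ∀ x y : E, (inner ℝ (τ x) (τ y) : ℝ) = α * inner ℝ x y)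
    (w : ι → E) (f : κ → E) (hli : LinearIndependent ℝ (Sum.elim w f))
    (hww : ∀ i j, (inner ℝ (τ (w i)) (w j) : ℝ) = 0)
    (hwf : ∀ i j, (inner ℝ (τ (w i)) (f j) : ℝ) = 0)
    (hfw : ∀ i j, (inner ℝ (τ (f i)) (w j) : ℝ) = 0)
    (hdet : 1 ≤ (det (Matrix.of fun i j => (inner ℝ (τ (f i)) (f j) : ℝ))) ^ 2) :
    det (gram ℝ w) ^ 2 ≤ α ^ Fintype.card κ * det (gram ℝ (Sum.elim w f)) ^ 2 := by
  have hw : LinearIndependent ℝ w := hli.comp Sum.inl Sum.inl_injective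
  have hA : 0 < det (gram ℝ w) := (posDef_gram_of_linearIndependent hw).det_pos
  have hS : 0 < det (gram ℝ (Sum.elim w f)) := (posDef_gram_of_linearIndependent hli).det_pos
  have hAu : IsUnit (det (gram ℝ w)) := isUnit_iff_ne_zero.2 hA.ne'
  let : Invertible (gram ℝ w) := invertibleOfIsUnitDet _ hAu
  let Bm : Matrix ι κ ℝ := Matrix.of fun i j => inner ℝ (w i) (f j)
  have hblk : gram ℝ (Sum.elim w f) = fromBlocks (gram ℝ w) Bm Bmᵀ (gram ℝ f) := by
    ext i j
    rcases i with i | i <;> rcases j with j | j <;> simp [gram_apply, Bm, real_inner_comm]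
  let X := ⅟(gram ℝ w) * Bm
  let f' : κ → E := fun j => f j - ∑ k, X k j • w k
  have hAX : gram ℝ w * X = Bm := by simp [X]
  have hwf' : ∀ i j, (inner ℝ (w i) (f' j) : ℝ) = 0 := by
    intro i j
    have := congrFun (congrFun hAX i) j
    simp only [f', inner_sub_right, inner_sum, real_inner_smul_right]
    rw [Matrix.mul_apply] at this
    simp only [gram_apply, Bm, Matrix.of_apply] at this
    rw [← this, sub_eq_zero]
    exact Finset.sum_congr rfl fun k _ => mul_comm _ _
  have hg' : gram ℝ f' = gram ℝ f - Bmᵀ * ⅟(gram ℝ w) * Bm := by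
    ext i j
    rw [gram_apply]
    have h1 : (inner ℝ (f' i) (f' j) : ℝ) = inner ℝ (f i) (f' j) := by
      conv_lhs => simp only [f']
      rw [inner_sub_left, sum_inner]
      simp only [real_inner_smul_left]
      have : ∀ k, (inner ℝ (w k) (f j - ∑ k, X k j • w k) : ℝ) = 0 := fun k => hwf' k j
      simp [this, f']
    rw [h1, Matrix.mul_assoc]
    change _ = gram ℝ f i j - (Bmᵀ * X) i j
    rw [Matrix.mul_apply]
    simp only [f', inner_sub_right, inner_sum, real_inner_smul_right, gram_apply,
      Matrix.transpose_apply, Bm, Matrix.of_apply]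
    congr 1
    exact Finset.sum_congr rfl fun k _ => by rw [real_inner_comm, mul_comm]
  have hfac : det (gram ℝ (Sum.elim w f)) = det (gram ℝ w) * det (gram ℝ f') := by
    rw [hblk, det_fromBlocks₁₁, hg']
  have hf'ne : det (gram ℝ f') ≠ 0 := by
    intro h; rw [h, mul_zero] at hfac; exact hS.ne' hfac
  have hf'li : LinearIndependent ℝ f' := linearIndependent_of_det_gram_ne_zero hf'ne
  have h1 := det_bform_le τ α hα hτ f' hf'li
  have h2 : (Matrix.of fun i j => (inner ℝ (τ (f' i)) (f' j) : ℝ)) =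
      Matrix.of fun i j => (inner ℝ (τ (f i)) (f j) : ℝ) := by
    ext i j
    simp [f', inner_sub_left, inner_sub_right, inner_sum, sum_inner, real_inner_smul_left,
      real_inner_smul_right, hww, hwf, hfw]
  rw [h2] at h1
  rw [hfac, mul_pow]
  have h3 := hdet.trans h1
  nlinarith [sq_nonneg (det (gram ℝ w))]

theorem numeric {α c m cw cf : ℝ} {r s d n : ℕ} (hα : 0 < α) (hc : 0 < c) (_hm : 0 ≤ m) (hs : s ≠ 0)
    (hn : n ≠ 0)
    (hd : d = r + s) (h1 : c ^ d = cf) (h2 : c ^ r ≤ cw) (h3 : cw ^ 4 ≤ α ^ s * cf ^ 4)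
    (h4 : α ^ n * (m ^ n) ^ 4 = 1) (h5 : c < m) : False := by
  have h6 : α * m ^ 4 = 1 := by
    have : (α * m ^ 4) ^ n = 1 := by rw [← h4]; ring
    exact (pow_eq_one_iff_of_nonneg (by positivity) hn).1 this
  have h7 : (c ^ r) ^ 4 ≤ (c ^ r) ^ 4 * (α * c ^ 4) ^ s := by
    calc (c ^ r) ^ 4 ≤ cw ^ 4 := by gcongr
      _ ≤ _ := h3
      _ = _ := by rw [← h1, hd]; ring
  have h8 : 1 ≤ (α * c ^ 4) ^ s := by
    have : 0 < (c ^ r) ^ 4 := by positivity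
    nlinarith
  have h9 : α * c ^ 4 < 1 := by rw [← h6]; gcongr
  have := pow_lt_one₀ (by positivity) h9 hs
  linarith

theorem latIn_basis_facts [FiniteDimensional ℝ E] (L : Submodule ℤ E) (hL : DiscreteTopology L)
    (F : Submodule ℝ E) (hF : IsRational L F) {ι : Type*} [Fintype ι] [DecidableEq ι]
    (b : Basis ι ℤ (latIn L F)) :
    LinearIndependent ℝ (fun i => ((b i : F) : E)) ∧ finrank ℝ F = Fintype.card ι ∧
    covol (latIn L F) ^ 2 = Matrix.det (Matrix.gram ℝ (fun i => ((b i : F) : E))) ∧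
    0 < covol (latIn L F) := by
  have := latIn_discrete L hL F
  have : IsZLattice ℝ (latIn L F) := ⟨latIn_zlattice L F hF⟩
  let B : Basis ι ℝ F := b.ofZLatticeBasis ℝ _
  have hB : ∀ i, B i = (b i : F) := fun i => b.ofZLatticeBasis_apply ℝ _ i
  have hli : LinearIndependent ℝ (fun i => ((b i : F) : E)) := by
    have h1 := B.linearIndependent.map' F.subtype F.ker_subtype
    have h2 : (fun i => ((b i : F) : E)) = F.subtype ∘ B := by
      funext i
      simp [hB]
    rw [h2]
    exact h1
  have hpos := (Matrix.posDef_gram_of_linearIndependent hli).det_pos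
  have hc : covol (latIn L F) = Real.sqrt (Matrix.det (Matrix.gram ℝ (fun i => ((b i : F) : E)))) :=
    covol_eq (latIn L F) b
  refine ⟨hli, Module.finrank_eq_card_basis B, ?_, ?_⟩
  · rw [hc, Real.sq_sqrt hpos.le]
  · rw [hc]; exact Real.sqrt_pos.2 hpos

theorem covol_nonneg (L : Submodule ℤ E) : 0 ≤ covol L := by
  unfold covol
  split_ifs
  · exact Real.sqrt_nonneg _
  · exact le_rfl

theorem Hmin_le (L : Submodule ℤ E) (F : Submodule ℝ E) (h0 : F ≠ ⊥) (hF : IsRational L F) :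
    Hmin L ≤ Hr L F := by
  apply csInf_le
  · refine ⟨0, ?_⟩
    rintro _ ⟨F, -, -, rfl⟩
    exact Real.rpow_nonneg (covol_nonneg _) _
  · exact ⟨F, h0, hF, rfl⟩

theorem redH_pow (L : Submodule ℤ E) (h : finrank ℝ E ≠ 0) : redH L ^ finrank ℝ E = covol L :=
  Real.rpow_inv_natCast_pow (covol_nonneg L) h

/-- The integral radical of the form `b_τ` on `L ∩ F`. -/
def radical (L : Submodule ℤ E) (F : Submodule ℝ E) (τ : E →ₗ[ℝ] E) :
    Submodule ℤ (latIn L F) where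
  carrier := {x | ∀ y : latIn L F, bform τ ((x : F) : E) ((y : F) : E) = 0}
  zero_mem' := fun y => by simp [bform]
  add_mem' := by
    intro a b ha hb y
    have h1 := ha y
    have h2 := hb y
    simp only [bform] at h1 h2 ⊢
    simp [inner_add_left, h1, h2]
  smul_mem' := by
    intro z a ha y
    have h1 := ha y
    simp only [bform] at h1 ⊢
    simp [← Int.cast_smul_eq_zsmul ℝ, real_inner_smul_left, h1]

theorem radical_torsionFree (L : Submodule ℤ E) (F : Submodule ℝ E) (τ : E →ₗ[ℝ] E) :
    Module.IsTorsionFree ℤ (latIn L F ⧸ radical L F τ) := by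
  apply Module.IsTorsionFree.of_smul_eq_zero
  intro z q hq
  obtain ⟨x, rfl⟩ := Submodule.Quotient.mk_surjective _ q
  by_cases hz : z = 0
  · exact Or.inl hz
  right
  rw [← Submodule.Quotient.mk_smul, Submodule.Quotient.mk_eq_zero] at hq
  rw [Submodule.Quotient.mk_eq_zero]
  intro y
  have h1 := hq y
  have hz' : (z : ℝ) ≠ 0 := by exact_mod_cast hz
  simp only [bform] at h1 ⊢
  simpa [← Int.cast_smul_eq_zsmul ℝ, real_inner_smul_left, hz'] using h1

theorem exists_adapted {M : Type*} [AddCommGroup M] [Module.Finite ℤ M] [Module.Free ℤ M]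
    (R : Submodule ℤ M) (h : Module.IsTorsionFree ℤ (M ⧸ R)) :
    ∃ (r s : ℕ) (bW : Basis (Fin r) ℤ R) (bQ : Basis (Fin s) ℤ (M ⧸ R))
      (e : Basis (Fin r ⊕ Fin s) ℤ M), (∀ i, e (Sum.inl i) = (bW i : M)) ∧
      ∀ j, Submodule.Quotient.mk (e (Sum.inr j)) = bQ j :=
  ⟨_, _, Module.finBasis ℤ R, Module.finBasis ℤ (M ⧸ R), Module.Basis.sumQuot _ _,
    Module.Basis.sumQuot_inl _ _, Module.Basis.sumQuot_inr _ _⟩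

theorem statement7 {E : Type*} [NormedAddCommGroup E] [InnerProductSpace ℝ E]
    [FiniteDimensional ℝ E] (L : Submodule ℤ E) (hL : IsLat L)
    (τ : E →ₗ[ℝ] E) (hiso : IsIsodual L τ)
    (hform : (∀ x y, bform τ x y = bform τ y x) ∨ (∀ x, bform τ x x = 0))
    (hun : ¬ Semistable L) (E₁ : Submodule ℝ E) (hdest : IsDestabilizing L E₁) :
    (∀ x ∈ E₁, ∀ y ∈ E₁, bform τ x y = 0) ∧
    (finrank ℝ E₁ : ℝ) ≤ (finrank ℝ E : ℝ) / 2 := by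
  obtain ⟨⟨α, hα, hτ⟩, hdual⟩ := hiso
  obtain ⟨hE0, hErat, hEmin, -⟩ := hdest
  have hdisc := hL.1
  have hzl : IsZLattice ℝ L := ⟨hL.2⟩
  -- reflexivity of the form
  have hrefl : ∀ x y, bform τ x y = 0 → bform τ y x = 0 := by
    rcases hform with h | h
    · intro x y hxy; rw [h, hxy]
    · intro x y hxy
      have h1 := h (x + y)
      have h2 := h x
      have h3 := h y
      simp only [bform, map_add, inner_add_left, inner_add_right] at *
      linarith
  -- the form is integral on L
  have hint : ∀ x ∈ L, ∀ y ∈ L, ∃ m : ℤ, bform τ x y = m := by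
    intro x hx y hy
    have : τ x ∈ dualLat L := by rw [← hdual]; exact ⟨_, hx, rfl⟩
    obtain ⟨m, hm⟩ := this y hy
    exact ⟨m, by rw [bform, real_inner_comm, hm]⟩
  -- it suffices to prove isotropy
  suffices hisot : ∀ x ∈ E₁, ∀ y ∈ E₁, bform τ x y = 0 by
    refine ⟨hisot, ?_⟩
    have hinj : Function.Injective τ := by
      rw [← LinearMap.ker_eq_bot, LinearMap.ker_eq_bot']
      intro x hx
      have := hτ x x
      rw [hx, inner_zero_left] at this
      have h2 : (inner ℝ x x : ℝ) = 0 := by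
        rcases mul_eq_zero.1 this.symm with h | h
        · exact absurd h hα.ne'
        · exact h
      exact inner_self_eq_zero.1 h2
    have hle : E₁.map τ ≤ E₁ᗮ := by
      rintro _ ⟨x, hx, rfl⟩
      rw [Submodule.mem_orthogonal']
      intro y hy
      exact hisot x hx y hy
    have h1 := Submodule.finrank_mono hle
    rw [← (Submodule.equivMapOfInjective τ hinj E₁).finrank_eq] at h1
    have h2 := E₁.finrank_add_finrank_orthogonal
    have h3 : 2 * finrank ℝ E₁ ≤ finrank ℝ E := by omega
    have h4 : (2 : ℝ) * finrank ℝ E₁ ≤ finrank ℝ E := by exact_mod_cast h3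
    linarith
  -- lattice in E₁
  have hd1 := latIn_discrete L hdisc E₁
  have hRdef : ∀ x, x ∈ radical L E₁ τ ↔
      ∀ y : latIn L E₁, bform τ ((x : E₁) : E) ((y : E₁) : E) = 0 := fun x => Iff.rfl
  have htf := radical_torsionFree L E₁ τ
  generalize radical L E₁ τ = R at hRdef htf
  obtain ⟨r, s, bW, bQ, e, he1, he2⟩ := exists_adapted R htf
  let w := fun i => ((e (Sum.inl i) : E₁) : E)
  let f := fun i => ((e (Sum.inr i) : E₁) : E)
  obtain ⟨hli, hfin, hcov, hcpos⟩ := latIn_basis_facts L hdisc E₁ hErat e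
  have hwf : (fun i => ((e i : E₁) : E)) = Sum.elim w f := by
    ext i; rcases i with i | i <;> rfl
  rw [hwf] at hli hcov
  have hwR : ∀ i, e (Sum.inl i) ∈ R := by
    intro i
    rw [he1]
    exact (bW i).2
  -- W
  let W : Submodule ℝ E := Submodule.span ℝ (Set.range w)
  have hWE : W ≤ E₁ := by
    apply Submodule.span_le.2
    rintro _ ⟨i, rfl⟩
    exact (e (Sum.inl i) : E₁).2
  have hwL : ∀ i, w i ∈ L := fun i => (e (Sum.inl i)).2
  have hfL : ∀ i, f i ∈ L := fun i => (e (Sum.inr i)).2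
  have hWrat : IsRational L W := by
    apply le_antisymm
    · exact Submodule.span_le.2 (fun x hx => hx.2)
    · apply Submodule.span_le.2
      rintro _ ⟨i, rfl⟩
      exact Submodule.subset_span ⟨hwL i, Submodule.subset_span ⟨i, rfl⟩⟩
  have hWorth : ∀ x ∈ W, ∀ y ∈ L, y ∈ E₁ → bform τ x y = 0 := by
    intro x hx y hy hyE
    induction hx using Submodule.span_induction with
    | mem x h =>
      obtain ⟨i, rfl⟩ := h
      exact (hRdef _).1 (hwR i) ⟨⟨y, hyE⟩, hy⟩
    | zero => simp [bform]
    | add a b _ _ h1 h2 =>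
      simp only [bform] at *
      simp [inner_add_left, h1, h2]
    | smul a b _ h1 =>
      simp only [bform] at *
      simp [real_inner_smul_left, h1]
  have hRW : ∀ x : R, (((x : latIn L E₁) : E₁) : E) ∈ W := by
    intro x
    let ψ : R →ₗ[ℤ] E := (E₁.subtype.restrictScalars ℤ) ∘ₗ (latIn L E₁).subtype ∘ₗ R.subtype
    have h : ψ (∑ i, bW.repr x i • bW i) = ψ x := congrArg ψ (bW.sum_repr x)
    rw [map_sum] at h
    change ψ x ∈ W
    rw [← h]
    refine Submodule.sum_mem _ fun i _ => ?_
    rw [map_smul, ← Int.cast_smul_eq_zsmul ℝ]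
    refine Submodule.smul_mem _ _ (Submodule.subset_span ⟨i, ?_⟩)
    simp only [w, he1]
    rfl
  let φ : R →ₗ[ℤ] latIn L W :=
    { toFun := fun x => ⟨⟨((x : latIn L E₁) : E₁), hRW x⟩, (x : latIn L E₁).2⟩
      map_add' := fun x y => rfl
      map_smul' := fun z x => rfl }
  have hφ : Function.Bijective φ := by
    constructor
    · intro x y hxy
      have : ((((x : latIn L E₁) : E₁)) : E) = ((((y : latIn L E₁) : E₁)) : E) :=
        congrArg (fun z : latIn L W => ((z : W) : E)) hxy
      exact Subtype.ext (Subtype.ext (Subtype.ext this))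
    · intro y
      exact ⟨⟨⟨⟨((y : W) : E), hWE y.1.2⟩, y.2⟩,
        (hRdef _).2 fun z => hWorth _ y.1.2 _ z.2 z.1.2⟩, rfl⟩
  let bW' : Basis _ ℤ (latIn L W) := bW.map (LinearEquiv.ofBijective φ hφ)
  have hbW' : (fun i => ((bW' i : W) : E)) = w := by
    ext i
    simp [bW', w, φ, he1]
  obtain ⟨-, hfinW, hcovW, hcposW⟩ := latIn_basis_facts L hdisc W hWrat bW'
  rw [hbW'] at hcovW
  -- integer Gram matrix of `f`
  choose M hM using fun i j => hint (f i) (hfL i) (f j) (hfL j)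
  have hdetM : Matrix.det (Matrix.of M) ≠ 0 := by
    intro h0
    obtain ⟨v, hv0, hv⟩ := Matrix.exists_vecMul_eq_zero_iff.2 h0
    let x : latIn L E₁ := ∑ i, v i • e (Sum.inr i)
    have hxE : ((x : E₁) : E) = ∑ i, (v i : ℝ) • f i := by
      simp [x, f, Int.cast_smul_eq_zsmul]
    have hfx : ∀ j, bform τ x (f j) = 0 := by
      intro j
      have h1 : ∑ i, v i * M i j = 0 := by
        have := congrFun hv j
        simpa [Matrix.vecMul, dotProduct] using this
      rw [hxE, bform]
      simp only [map_sum, map_smul, sum_inner, real_inner_smul_left]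
      have h2 : ∀ i, (inner ℝ (τ (f i)) (f j) : ℝ) = M i j := fun i => hM i j
      simp only [h2]
      exact_mod_cast h1
    have hwx : ∀ j, bform τ x (w j) = 0 := by
      intro j
      exact hrefl _ _ ((hRdef _).1 (hwR j) x)
    have hx : x ∈ R := by
      rw [hRdef]
      intro y
      let ψ : latIn L E₁ →ₗ[ℤ] E := (E₁.subtype.restrictScalars ℤ) ∘ₗ (latIn L E₁).subtype
      have h : ψ (∑ i, e.repr y i • e i) = ψ y := congrArg ψ (e.sum_repr y)
      rw [map_sum] at h
      change bform τ x (ψ y) = 0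
      rw [← h, bform, inner_sum]
      refine Finset.sum_eq_zero fun i _ => ?_
      rw [map_smul, ← Int.cast_smul_eq_zsmul ℝ, real_inner_smul_right]
      rcases i with i | i
      · exact mul_eq_zero_of_right _ (hwx i)
      · exact mul_eq_zero_of_right _ (hfx i)
    have h1 : R.mkQ x = 0 := (Submodule.Quotient.mk_eq_zero R).2 hx
    have h2 : ∑ i, v i • bQ i = 0 := by
      rw [← h1]
      simp [x, he2]
    have h3 := Fintype.linearIndependent_iff.1 bQ.linearIndependent v h2
    exact hv0 (funext h3)
  have hdet1 : 1 ≤ (Matrix.det (Matrix.of fun i j => (inner ℝ (τ (f i)) (f j) : ℝ))) ^ 2 := by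
    have h3 : Matrix.det (Matrix.of fun i j => (inner ℝ (τ (f i)) (f j) : ℝ)) =
        ((Matrix.det (Matrix.of M) : ℤ) : ℝ) := by
      have h5 := (Int.castRingHom ℝ).map_det (Matrix.of M)
      simp only [eq_intCast] at h5
      rw [h5]
      congr 1
      ext i j
      simpa [bform] using hM i j
    rw [h3]
    have : 0 < Matrix.det (Matrix.of M) ^ 2 := by positivity
    exact_mod_cast this
  have hwE : ∀ i, w i ∈ E₁ := fun i => (e (Sum.inl i) : E₁).2
  have hfE : ∀ i, f i ∈ E₁ := fun i => (e (Sum.inr i) : E₁).2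
  have hwW : ∀ i, w i ∈ W := fun i => Submodule.subset_span ⟨i, rfl⟩
  have hmain := gram_sum_le τ α hα hτ w f hli
    (fun i j => hWorth _ (hwW i) _ (hwL j) (hwE j))
    (fun i j => hWorth _ (hwW i) _ (hfL j) (hfE j))
    (fun i j => hrefl _ _ (hWorth _ (hwW j) _ (hfL i) (hfE i))) hdet1
  rw [← hcov, ← hcovW] at hmain
  -- slope comparison
  by_contra hnot
  have hs : Fintype.card (Fin s) ≠ 0 := by
    intro h0
    apply hnot
    have hWE' : W = E₁ := by
      apply Submodule.eq_of_le_of_finrank_eq hWE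
      rw [hfin, hfinW, Fintype.card_sum, h0, add_zero]
    intro x hx y hy
    rw [← hErat] at hy
    induction hy using Submodule.span_induction with
    | mem y h => exact hWorth x (hWE' ▸ hx) y h.1 h.2
    | zero => simp [bform]
    | add a b _ _ h1 h2 =>
      simp only [bform] at *
      simp [inner_add_right, h1, h2]
    | smul a b _ h1 =>
      simp only [bform] at *
      simp [real_inner_smul_right, h1]
  have hd0 : finrank ℝ E₁ ≠ 0 := fun h => hE0 (Submodule.finrank_eq_zero.1 h)
  have hn0 : finrank ℝ E ≠ 0 := by
    have := E₁.finrank_le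
    omega
  have hc : 0 < Hr L E₁ := Real.rpow_pos_of_pos hcpos _
  have hlt : Hr L E₁ < redH L := by
    unfold Semistable at hun
    push Not at hun
    obtain ⟨F, hF0, hFr, hF⟩ := hun
    rw [hEmin]
    exact (Hmin_le L F hF0 hFr).trans_lt hF
  have hWle : Hr L E₁ ^ finrank ℝ W ≤ covol (latIn L W) := by
    by_cases hW0 : W = ⊥
    · have h0 : finrank ℝ W = 0 := by rw [hW0]; simp
      have : IsEmpty (Fin r) := by
        rw [← Fintype.card_eq_zero_iff, ← hfinW, h0]
      rw [Matrix.det_isEmpty] at hcovW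
      rw [h0, pow_zero]
      nlinarith
    · have h0 : finrank ℝ W ≠ 0 := fun h => hW0 (Submodule.finrank_eq_zero.1 h)
      rw [← redH_pow (latIn L W) h0]
      have : Hr L E₁ ≤ redH (latIn L W) := by
        rw [hEmin]; exact Hmin_le L W hW0 hWrat
      gcongr
  let bL := Module.Free.chooseBasis ℤ L
  have huni := unimod L τ α hτ hdual bL
  have hcardL : Fintype.card (Module.Free.ChooseBasisIndex ℤ L) = finrank ℝ E :=
    (Module.finrank_eq_card_basis (bL.ofZLatticeBasis ℝ L)).symm
  have hcL : covol L ^ 2 = Matrix.det (Matrix.gram ℝ (fun i => (bL i : E))) := by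
    rw [covol_eq L bL, Real.sq_sqrt (Matrix.posSemidef_gram ℝ _).det_nonneg]
  rw [hcardL, ← hcL] at huni
  refine numeric (n := finrank ℝ E) (m := redH L) hα hc (hc.le.trans hlt.le) hs hn0 (d := finrank ℝ E₁)
    (r := finrank ℝ W) ?_ (redH_pow (latIn L E₁) hd0) hWle ?_ ?_ hlt
  · rw [hfin, hfinW, Fintype.card_sum]
  · calc _ = (covol (latIn L W) ^ 2) ^ 2 := by ring
      _ ≤ _ := hmain
      _ = _ := by ring
  · rw [redH_pow L hn0, ← huni]; ring

end EucLat
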